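/- In any configuration C, if a node u satisfies h(u) < h*(u), then the subtree S_u rooted at u contains at least one bad node. -/

import Mathlib

open scoped Classical

/-- A pre-configuration: a finite node set `V` with a partial parent map
(`none` means the node has no parent) and an integer height assignment. -/
structure PreConfig (V : Type*) where
  parent : V → Option V
  height : V → ℤ

namespace PreConfig

variable {V : Type*} [Fintype V] [LinearOrder V]

/-- The children of `u` are the nodes whose parent is `u`. -/
noncomputable def children (C : PreConfig V) (u : V) : Finset V :=
  Finset.univ.filter (fun v => C.parent v = some u)

/-- A leaf is a node with no children. -/
def IsLeaf (C : PreConfig V) (u : V) : Prop := C.children u = ∅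

/-- Maximum height value among the children of `u` (junk value `0` for a leaf). -/
noncomputable def maxH (C : PreConfig V) (u : V) : ℤ :=
  if h : (C.children u).Nonempty then (C.children u).sup' h C.height else 0

/-- Minimum height value among the children of `u` (junk value `0` for a leaf). -/
noncomputable def minH (C : PreConfig V) (u : V) : ℤ :=
  if h : (C.children u).Nonempty then (C.children u).inf' h C.height else 0

/-- A child of `u` of maximum height value; ties broken by a fixed rule
(smallest ID). Junk value `u` for a leaf. -/
noncomputable def maxChild (C : PreConfig V) (u : V) : V :=
  if h : ((C.children u).filter fun v => C.height v = C.maxH u).Nonempty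
  then ((C.children u).filter fun v => C.height v = C.maxH u).min' h else u

/-- A child of `u` of minimum height value; ties broken by a fixed rule
(smallest ID). Junk value `u` for a leaf. -/
noncomputable def minChild (C : PreConfig V) (u : V) : V :=
  if h : ((C.children u).filter fun v => C.height v = C.minH u).Nonempty
  then ((C.children u).filter fun v => C.height v = C.minH u).min' h else u

/-- `stable(u)`: `h(u) = 0` if `u` is a leaf, and `h(u) = 1 + max_{w child of u} h(w)` otherwise. -/
def Stable (C : PreConfig V) (u : V) : Prop :=
  (C.IsLeaf u ∧ C.height u = 0) ∨ (¬ C.IsLeaf u ∧ C.height u = 1 + C.maxH u)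

/-- `balanced(u)`: `|h(z) − h(z')| ≤ α` for all children `z, z'` of `u`. -/
def Balanced (α : ℤ) (C : PreConfig V) (u : V) : Prop :=
  ∀ z ∈ C.children u, ∀ z' ∈ C.children u, |C.height z - C.height z'| ≤ α

/-- `u` is enabled for a height update iff `¬stable(u)`. -/
def UpdateEnabled (C : PreConfig V) (u : V) : Prop := ¬ C.Stable u

/-- `u` is enabled for a swap iff `stable(u) ∧ stable(max(u)) ∧ ¬balanced(u)`. -/
def SwapEnabled (α : ℤ) (C : PreConfig V) (u : V) : Prop :=
  C.Stable u ∧ C.Stable (C.maxChild u) ∧ ¬ Balanced α C u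

/-- `u` is enabled iff it is enabled for a height update or for a swap. -/
def Enabled (α : ℤ) (C : PreConfig V) (u : V) : Prop :=
  C.UpdateEnabled u ∨ SwapEnabled α C u

/-- The value written by a height update: `0` for a leaf, `1 + max_{w child of u} h(w)` otherwise. -/
noncomputable def newHeight (C : PreConfig V) (u : V) : ℤ :=
  if C.IsLeaf u then 0 else 1 + C.maxH u

/-- A bad node: an internal node `u` with `h(u) ≤ max_{v child of u} h(v)`,
or a leaf `u` with `h(u) < 0`. -/
def Bad (C : PreConfig V) (u : V) : Prop :=
  (¬ C.IsLeaf u ∧ C.height u ≤ C.maxH u) ∨ (C.IsLeaf u ∧ C.height u < 0)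

/-- `v` reaches `a` by iterating the parent map. -/
def Reaches (C : PreConfig V) (v a : V) : Prop :=
  Relation.ReflTransGen (fun x y => C.parent x = some y) v a

/-- The underlying graph is a rooted tree with root `r`: `r` has no parent,
every other node has a (unique) parent, and every node reaches `r` by
iterating the parent map. -/
def IsTree (C : PreConfig V) (r : V) : Prop :=
  C.parent r = none ∧ (∀ v, C.parent v = none → v = r) ∧ ∀ v, C.Reaches v r

/-- The subtree `S_u` of `u`: the set of descendants of `u` (including `u`). -/
def subtree (C : PreConfig V) (u : V) : Set V := {v | C.Reaches v u}

/-- The actual height `h*(u)` of `u`: the length of a longest directed path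
going downward from `u` (such a maximal path necessarily ends at a leaf of `S_u`). -/
noncomputable def hstar (C : PreConfig V) (u : V) : ℕ :=
  sSup {n : ℕ | ∃ f : ℕ → V, f 0 = u ∧ ∀ i < n, C.parent (f (i + 1)) = some (f i)}

/-- An execution step `C →_A C'`: a nonempty set `A` of nodes enabled in `C` is
activated simultaneously; each `u ∈ A` enabled for a height update sets its height
to `newHeight`; each `u ∈ A` enabled for a swap replaces the edges `(u, min(u))` and
`(max(u), max(max(u)))` by `(u, max(max(u)))` and `(max(u), min(u))` (all guards and
functions evaluated in `C`); everything else is unchanged. -/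
structure Step (α : ℤ) (C C' : PreConfig V) (A : Finset V) : Prop where
  nonempty : A.Nonempty
  all_enabled : ∀ u ∈ A, Enabled α C u
  height_update : ∀ u ∈ A, C.UpdateEnabled u → C'.height u = C.newHeight u
  height_keep : ∀ u, ¬ (u ∈ A ∧ C.UpdateEnabled u) → C'.height u = C.height u
  swap_out : ∀ u ∈ A, SwapEnabled α C u → C'.parent (C.minChild u) = some (C.maxChild u)
  swap_in : ∀ u ∈ A, SwapEnabled α C u → C'.parent (C.maxChild (C.maxChild u)) = some u
  parent_keep : ∀ v, (∀ u ∈ A, SwapEnabled α C u →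
      v ≠ C.minChild u ∧ v ≠ C.maxChild (C.maxChild u)) → C'.parent v = C.parent v

end PreConfig

namespace PreConfig

variable {V : Type*}

theorem mem_subtree_of_parent {C : PreConfig V} {u v w : V} (hv : v ∈ C.subtree u)
    (hw : C.parent w = some v) : w ∈ C.subtree u :=
  Relation.ReflTransGen.head hw hv

theorem exists_path_length_hstar (C : PreConfig V) (u : V) :
    ∃ f : ℕ → V, f 0 = u ∧ ∀ i < C.hstar u, C.parent (f (i + 1)) = some (f i) := by
  let lengths : Set ℕ :=
    {n | ∃ f : ℕ → V, f 0 = u ∧ ∀ i < n, C.parent (f (i + 1)) = some (f i)}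
  have hzero : 0 ∈ lengths := ⟨fun _ => u, rfl, by simp⟩
  change sSup lengths ∈ lengths
  by_cases hb : BddAbove lengths
  · exact Nat.sSup_mem ⟨0, hzero⟩ hb
  · rwa [Nat.sSup_of_not_bddAbove hb]

variable [Fintype V] [LinearOrder V]

theorem mem_children {C : PreConfig V} {u v : V} :
    v ∈ C.children u ↔ C.parent v = some u := by
  simp [children]

theorem height_lt_of_not_bad {C : PreConfig V} {v w : V} (hv : ¬ C.Bad v)
    (hw : C.parent w = some v) : C.height w < C.height v := by
  have hmem : w ∈ C.children v := mem_children.2 hw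
  have hne : (C.children v).Nonempty := ⟨w, hmem⟩
  have hle : C.height w ≤ C.maxH v := by
    rw [maxH, dif_pos hne]
    exact Finset.le_sup' C.height hmem
  by_contra! hlt
  exact hv (Or.inl ⟨hne.ne_empty, hlt.trans hle⟩)

theorem height_nonneg_of_not_bad {C : PreConfig V} {u : V}
    (hgood : ∀ v ∈ C.subtree u, ¬ C.Bad v) {v : V} (hv : v ∈ C.subtree u) :
    0 ≤ C.height v := by
  obtain ⟨m, hm, hmin⟩ :=
    Set.exists_min_image (C.subtree u) C.height (Set.toFinite _) ⟨v, hv⟩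
  refine le_trans ?_ (hmin v hv)
  rcases (C.children m).eq_empty_or_nonempty with hleaf | ⟨w, hw⟩
  · by_contra! hneg
    exact hgood m hm (Or.inr ⟨hleaf, hneg⟩)
  · have hw := mem_children.1 hw
    exact absurd (hmin w (mem_subtree_of_parent hm hw))
      (height_lt_of_not_bad (hgood m hm) hw).not_ge

theorem hstar_le_height_of_not_bad {C : PreConfig V} {u : V}
    (hgood : ∀ v ∈ C.subtree u, ¬ C.Bad v) : (C.hstar u : ℤ) ≤ C.height u := by
  obtain ⟨f, hf0, hf⟩ := C.exists_path_length_hstar u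
  have hpath : ∀ i ≤ C.hstar u, f i ∈ C.subtree u ∧ C.height (f i) + i ≤ C.height u := by
    intro i
    induction i with
    | zero => exact fun _ => ⟨hf0 ▸ Relation.ReflTransGen.refl, by simp [hf0]⟩
    | succ i ih =>
      intro hi
      obtain ⟨hmem, hle⟩ := ih (by omega)
      have hlt := height_lt_of_not_bad (hgood _ hmem) (hf i hi)
      exact ⟨mem_subtree_of_parent hmem (hf i hi), by push_cast; omega⟩
  obtain ⟨hmem, hle⟩ := hpath _ le_rfl
  have := height_nonneg_of_not_bad hgood hmem
  omega

end PreConfig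

/-- In any configuration `C`, if a node `u` satisfies `h(u) < h*(u)`,
then the subtree `S_u` rooted at `u` contains at least one bad node. -/
theorem stmt16 {V : Type*} [Fintype V] [LinearOrder V]
    (C : PreConfig V) (r : V) (hT : C.IsTree r)
    (u : V) (h : C.height u < (C.hstar u : ℤ)) :
    ∃ v ∈ C.subtree u, C.Bad v := by
  by_contra! hgood
  exact (PreConfig.hstar_le_height_of_not_bad hgood).not_gt h
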